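/- There is no triangulation of the 2-sphere in which the degrees of all vertices except exactly one are divisible by 5. -/

import Mathlib

/-!
Combinatorial triangulated surfaces.

A triangulation is encoded by its finset of faces (each a 3-element finset of
vertices).  `IsClosedSurface` says: nonempty, every face a triangle, every edge
in exactly two faces, and the faces around each vertex are connected through
edges containing that vertex (so the link of every vertex is a single cycle).
A connected closed surface with Euler characteristic 2 is a sphere, with
Euler characteristic 1 is the projective plane, and an orientable one with
Euler characteristic 0 is the torus.  Surfaces with boundary allow edges lying
in exactly one face; a connected such surface is simply connected iff it is a
disk (Euler characteristic 1, with boundary) or a sphere (Euler characteristic 2).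
The degree of a vertex is the number of edges containing it.
-/

namespace Fisk

variable {V : Type*} [DecidableEq V]

/-- The edges of a triangulation: the 2-element subsets of its faces. -/
def edges (F : Finset (Finset V)) : Finset (Finset V) :=
  F.biUnion (fun f => f.powersetCard 2)

/-- The vertex set of a triangulation. -/
def vertices (F : Finset (Finset V)) : Finset V := F.sup id

/-- The degree of a vertex: the number of edges containing it. -/
def degree (F : Finset (Finset V)) (v : V) : ℕ :=
  ((edges F).filter (fun e => v ∈ e)).card

/-- Two vertices are adjacent if they span an edge. -/
def IsAdjacent (F : Finset (Finset V)) (a b : V) : Prop :=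
  a ≠ b ∧ ({a, b} : Finset V) ∈ edges F

/-- The faces are connected under the relation "share an edge". -/
def FacesConnected (F : Finset (Finset V)) : Prop :=
  ∀ f ∈ F, ∀ g ∈ F,
    Relation.ReflTransGen (fun x y => x ∈ F ∧ y ∈ F ∧ (x ∩ y).card = 2) f g

/-- Around every vertex, the faces containing it are connected through
edges containing it (links are connected). -/
def LinkConnected (F : Finset (Finset V)) : Prop :=
  ∀ v : V, ∀ f ∈ F, ∀ g ∈ F, v ∈ f → v ∈ g →
    Relation.ReflTransGen
      (fun x y => x ∈ F ∧ y ∈ F ∧ v ∈ x ∧ v ∈ y ∧ (x ∩ y).card = 2) f g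

/-- A triangulation of a closed surface. -/
def IsClosedSurface (F : Finset (Finset V)) : Prop :=
  F.Nonempty ∧ (∀ f ∈ F, f.card = 3) ∧
  (∀ e ∈ edges F, (F.filter (fun f => e ⊆ f)).card = 2) ∧
  LinkConnected F

/-- The Euler characteristic `#V - #E + #F`. -/
def eulerChar (F : Finset (Finset V)) : ℤ :=
  ((vertices F).card : ℤ) - ((edges F).card : ℤ) + (F.card : ℤ)

/-- A triangulation of the 2-sphere: a connected closed surface with
Euler characteristic 2. -/
def IsSphere (F : Finset (Finset V)) : Prop :=
  IsClosedSurface F ∧ FacesConnected F ∧ eulerChar F = 2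

/-- The oriented edges of an ordered triple. -/
def orientedEdges (t : V × V × V) : Finset (V × V) :=
  {(t.1, t.2.1), (t.2.1, t.2.2), (t.2.2, t.1)}

/-- Orientability: each face can be given a cyclic order of its vertices so
that no directed edge is induced by two different faces (i.e. adjacent faces
induce opposite orientations on their common edge). -/
def Orientable (F : Finset (Finset V)) : Prop :=
  ∃ o : Finset V → V × V × V,
    (∀ f ∈ F, ({(o f).1, (o f).2.1, (o f).2.2} : Finset V) = f) ∧
    (∀ f ∈ F, ∀ g ∈ F, f ≠ g → ∀ p ∈ orientedEdges (o f), p ∉ orientedEdges (o g))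

/-- A triangulation of the torus: a connected orientable closed surface with
Euler characteristic 0. -/
def IsTorus (F : Finset (Finset V)) : Prop :=
  IsClosedSurface F ∧ FacesConnected F ∧ Orientable F ∧ eulerChar F = 0

/-- A triangulation of the projective plane: a connected closed surface with
Euler characteristic 1. -/
def IsProjectivePlane (F : Finset (Finset V)) : Prop :=
  IsClosedSurface F ∧ FacesConnected F ∧ eulerChar F = 1

/-- A triangulation of a surface, possibly with boundary: every edge lies in
one or two faces. -/
def IsSurfaceWithBoundary (F : Finset (Finset V)) : Prop :=
  F.Nonempty ∧ (∀ f ∈ F, f.card = 3) ∧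
  (∀ e ∈ edges F,
    (F.filter (fun f => e ⊆ f)).card = 1 ∨ (F.filter (fun f => e ⊆ f)).card = 2) ∧
  LinkConnected F

/-- The boundary edges: edges lying in exactly one face. -/
def boundaryEdges (F : Finset (Finset V)) : Finset (Finset V) :=
  (edges F).filter (fun e => (F.filter (fun f => e ⊆ f)).card = 1)

/-- The boundary vertices: vertices of boundary edges. -/
def boundaryVertices (F : Finset (Finset V)) : Finset V :=
  (boundaryEdges F).sup id

/-- A compact connected surface (possibly with boundary) is simply connected
iff it is a sphere (χ = 2) or a disk (χ = 1, nonempty boundary). -/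
def IsSimplyConnectedSurface (F : Finset (Finset V)) : Prop :=
  IsSurfaceWithBoundary F ∧ FacesConnected F ∧
    (eulerChar F = 2 ∨ (eulerChar F = 1 ∧ (boundaryEdges F).Nonempty))

/-- A triangulation of a disk (= of a polygon, the corners being the boundary
vertices): a connected surface with nonempty boundary and Euler characteristic 1. -/
def IsDisk (F : Finset (Finset V)) : Prop :=
  IsSurfaceWithBoundary F ∧ FacesConnected F ∧ eulerChar F = 1 ∧
    (boundaryEdges F).Nonempty

/-- A proper vertex coloring: the two endpoints of every edge get distinct
colors (for a triangulation: every triangle receives all three colors). -/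
def ProperColoring {C : Type*} (F : Finset (Finset V)) (c : V → C) : Prop :=
  ∀ e ∈ edges F, ∀ u ∈ e, ∀ w ∈ e, u ≠ w → c u ≠ c w

end Fisk


namespace SimpleGraph

/-- A finite forest with at least one edge has a leaf different from any prescribed vertex. -/
theorem IsAcyclic.exists_leaf_ne {W : Type*} [Finite W] {G : SimpleGraph W} (hG : G.IsAcyclic)
    (hne : G ≠ ⊥) (a : W) : ∃ v w, v ≠ a ∧ G.Adj v w ∧ ∀ w', G.Adj v w' → w' = w := by
  classical
  have := Fintype.ofFinite W
  have : Nonempty W := ⟨a⟩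
  obtain ⟨u, v, p, hp, hmax⟩ := Walk.exists_isPath_forall_isPath_length_le_length G
  obtain ⟨x, y, hxy⟩ := ne_bot_iff_exists_adj.mp hne
  have hlen : 0 < p.length := by
    have : 1 ≤ p.length := by simpa using hmax _ _ hxy.toWalk (by simp [hxy.ne])
    lia
  have hnil : ¬ p.Nil := by
    intro h
    rw [← Walk.length_eq_zero_iff] at h
    lia
  have huv : u ≠ v := hp.nil_iff_eq.not.mp hnil
  by_cases hu : u = a
  · refine ⟨v, _, fun h ↦ huv (hu.trans h.symm), (p.adj_penultimate hnil).symm, fun w hadj ↦ ?_⟩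
    apply hG.eq_penultimate_of_adj_end hp hadj
    have : ¬(p.concat hadj).IsPath := by grind [Walk.length_concat]
    grind [hp.concat]
  · refine ⟨u, _, hu, p.adj_snd hnil, fun w hadj ↦ ?_⟩
    apply hG.eq_snd_of_adj_start hp hadj
    have : ¬(p.cons hadj.symm).IsPath := by grind [Walk.length_cons]
    grind [hp.cons]

/-- If labels extend across every edge of a finite forest, then the vertices can be labelled
consistently along all edges. -/
theorem IsAcyclic.exists_compatible_labelling {W X : Type*} [Finite W] {R : W → W → X → X → Prop}
    {p : W → X → Prop} (hp : ∀ w, ∃ x, p w x)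
    (hR : ∀ v w x y, R v w x y → R w v y x) (G : SimpleGraph W) (hG : G.IsAcyclic)
    (hext : ∀ v w, G.Adj v w → ∀ x, p v x → ∃ y, p w y ∧ R v w x y) :
    ∃ s : W → X, (∀ w, p w (s w)) ∧ ∀ v w, G.Adj v w → R v w (s v) (s w) := by
  classical
  induction G using WellFoundedLT.induction with
  | ind G ih =>
  by_cases hne : G = ⊥
  · choose s hs using hp
    exact ⟨s, hs, by simp [hne]⟩
  obtain ⟨x, -, -⟩ := ne_bot_iff_exists_adj.mp hne
  obtain ⟨v, w, -, hvw, huniq⟩ := hG.exists_leaf_ne hne x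
  have hle : G.deleteEdges {s(v, w)} ≤ G := G.deleteEdges_le _
  have hlt : G.deleteEdges {s(v, w)} < G :=
    lt_of_le_of_ne hle fun h ↦ by
      have := h ▸ hvw
      simp [deleteEdges_adj] at this
  obtain ⟨s, hs, hsR⟩ := ih _ hlt (hG.anti hle) fun a b hab ↦ hext a b (hle hab)
  obtain ⟨y, hy, hRy⟩ := hext w v hvw.symm (s w) (hs w)
  refine ⟨Function.update s v y, fun a ↦ ?_, fun a b hab ↦ ?_⟩
  · by_cases h : a = v
    · subst h; simpa using hy
    · simpa [h] using hs a
  · by_cases ha : a = v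
    · subst ha
      obtain rfl := huniq b hab
      simpa [hab.ne'] using hR _ _ _ _ hRy
    · by_cases hb : b = v
      · subst hb
        obtain rfl := huniq a hab.symm
        simpa [hab.ne] using hRy
      · simp only [Function.update_of_ne ha, Function.update_of_ne hb]
        apply hsR
        rw [deleteEdges_adj]
        refine ⟨hab, ?_⟩
        simp [ha, hb]

end SimpleGraph

namespace Fisk

/-- The triangles of the six-vertex triangulation of the projective plane, obtained from the
icosahedron by identifying antipodes: `5` is the apex, the other vertices are taken modulo `5`. -/
def hemiFaces : Finset (Finset (Fin 6)) :=
  {{5, 0, 1}, {5, 1, 2}, {5, 2, 3}, {5, 3, 4}, {5, 4, 0},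
    {0, 1, 3}, {1, 2, 4}, {2, 3, 0}, {3, 4, 1}, {4, 0, 2}}

/-- Coordinates `i ↦ linkCoord i` identifying the link of each vertex `i` of the six-vertex
projective plane with the five-cycle `ZMod 5`. -/
def linkCoord : Fin 6 → Fin 6 → ZMod 5 :=
  ![![0, 1, 3, 2, 4, 0],
    ![4, 0, 1, 3, 2, 0],
    ![2, 4, 0, 1, 3, 0],
    ![3, 2, 4, 0, 1, 0],
    ![1, 3, 2, 4, 0, 0],
    ![0, 1, 2, 3, 4, 0]]

theorem linkCoord_sub_mul_self : ∀ i x y : Fin 6, {i, x, y} ∈ hemiFaces →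
    (linkCoord i y - linkCoord i x) * (linkCoord i y - linkCoord i x) = 1 := by decide

theorem linkCoord_pair_iff : ∀ i x y : Fin 6, {i, x, y} ∈ hemiFaces →
    ∀ x' y' : Fin 6, {i, x', y'} ∈ hemiFaces →
    ((x = x' ∧ y ≠ y') ↔
      ((linkCoord i y - linkCoord i x) + (linkCoord i y' - linkCoord i x') = 0 ∧
      (linkCoord i y - linkCoord i x) * linkCoord i x +
        (linkCoord i y' - linkCoord i x') * linkCoord i x' = 0)) := by decide

theorem exists_ne_mem_hemiFaces : ∀ x y z : Fin 6, {x, y, z} ∈ hemiFaces →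
    ∃ z', z' ≠ z ∧ {x, y, z'} ∈ hemiFaces := by decide
variable {V : Type*} [DecidableEq V] {F : Finset (Finset V)}

theorem mem_edges {e : Finset V} : e ∈ edges F ↔ ∃ f ∈ F, e ⊆ f ∧ e.card = 2 := by
  simp [edges, Finset.mem_powersetCard]

theorem mem_vertices {v : V} : v ∈ vertices F ↔ ∃ f ∈ F, v ∈ f := by
  simp [vertices, Finset.mem_sup]

namespace IsClosedSurface

theorem card_eq_three (hF : IsClosedSurface F) {f : Finset V} (hf : f ∈ F) : f.card = 3 :=
  hF.2.1 f hf

theorem exists_two_faces (hF : IsClosedSurface F) {e : Finset V} (he : e ∈ edges F) :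
    ∃ f ∈ F, ∃ g ∈ F, f ≠ g ∧ e ⊆ f ∧ e ⊆ g ∧ F.filter (fun x ↦ e ⊆ x) = {f, g} := by
  obtain ⟨f, g, hne, h⟩ := Finset.card_eq_two.mp (hF.2.2.1 e he)
  have hf : f ∈ F.filter (fun x ↦ e ⊆ x) := by simp [h]
  have hg : g ∈ F.filter (fun x ↦ e ⊆ x) := by simp [h]
  rw [Finset.mem_filter] at hf hg
  exact ⟨f, hf.1, g, hg.1, hne, hf.2, hg.2, h⟩

theorem inter_eq (hF : IsClosedSurface F) {e f g : Finset V} (hf : f ∈ F) (hg : g ∈ F)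
    (hne : f ≠ g) (hef : e ⊆ f) (heg : e ⊆ g) (he : e.card = 2) : f ∩ g = e := by
  refine (Finset.eq_of_subset_of_card_le (Finset.subset_inter hef heg) ?_).symm
  rw [he]
  by_contra! h
  have h3 := hF.card_eq_three hf
  have h3' := hF.card_eq_three hg
  have hfi : f ∩ g = f := Finset.eq_of_subset_of_card_le Finset.inter_subset_left (by lia)
  have hgi : f ∩ g = g := Finset.eq_of_subset_of_card_le Finset.inter_subset_right (by lia)
  exact hne (hfi.symm.trans hgi)

theorem filter_eq_pair (hF : IsClosedSurface F) {e f g : Finset V} (hf : f ∈ F) (hg : g ∈ F)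
    (hne : f ≠ g) (hef : e ⊆ f) (heg : e ⊆ g) (he : e.card = 2) :
    F.filter (fun x ↦ e ⊆ x) = {f, g} := by
  symm
  apply Finset.eq_of_subset_of_card_le
  · intro x
    simp only [Finset.mem_insert, Finset.mem_singleton, Finset.mem_filter]
    rintro (rfl | rfl) <;> exact ⟨‹_›, ‹_›⟩
  · rw [hF.2.2.1 e (mem_edges.mpr ⟨f, hf, hef, he⟩), Finset.card_pair hne]

end IsClosedSurface

/-- Double counting of the incidences between faces at `v` and their other vertices. -/
theorem sum_link_comm {M : Type*} [AddCommMonoid M] (v : V) (h : Finset V → V → M) :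
    ∑ f ∈ F.filter (v ∈ ·), ∑ u ∈ f.erase v, h f u =
      ∑ u ∈ (vertices F).erase v, ∑ f ∈ F.filter (fun x ↦ {v, u} ⊆ x), h f u := by
  apply Finset.sum_comm'
  intro f u
  simp only [Finset.mem_filter, Finset.mem_erase, mem_vertices, Finset.insert_subset_iff,
    Finset.singleton_subset_iff]
  grind

theorem IsClosedSurface.degree_eq (hF : IsClosedSurface F) (v : V) :
    degree F v = (F.filter (v ∈ ·)).card := by
  have h := sum_link_comm (F := F) v (fun _ _ ↦ 1)
  have h1 : ∀ f ∈ F.filter (v ∈ ·), ∑ _u ∈ f.erase v, 1 = 2 := by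
    intro f hf
    rw [Finset.mem_filter] at hf
    simp [Finset.card_erase_of_mem hf.2, hF.card_eq_three hf.1]
  have h2 : ∀ u ∈ (vertices F).erase v, ∑ _f ∈ F.filter (fun x ↦ {v, u} ⊆ x), 1 =
      if {v, u} ∈ edges F then 2 else 0 := by
    intro u hu
    split_ifs with he
    · simp [hF.2.2.1 _ he]
    · rw [Finset.sum_eq_zero_iff]
      intro f hf
      rw [Finset.mem_filter] at hf
      exact absurd (mem_edges.mpr ⟨f, hf.1, hf.2,
        Finset.card_pair (Finset.ne_of_mem_erase hu).symm⟩) he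
  rw [Finset.sum_congr rfl h1, Finset.sum_congr rfl h2, ← Finset.sum_filter] at h
  simp only [Finset.sum_const, smul_eq_mul] at h
  have h3 : degree F v = (((vertices F).erase v).filter (fun u ↦ {v, u} ∈ edges F)).card := by
    symm
    apply Finset.card_bij (fun u _ ↦ {v, u})
    · intro u hu
      simp only [Finset.mem_filter] at hu
      simp [hu.2]
    · intro u hu w hw heq
      simp only [Finset.mem_filter, Finset.mem_erase] at hu hw
      have : u ∈ ({v, w} : Finset V) := heq ▸ by simp
      simpa [hu.1.1] using this
    · intro e he
      rw [Finset.mem_filter] at he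
      obtain ⟨f, hf, hef, hc⟩ := mem_edges.mp he.1
      have : (e.erase v).card = 1 := by rw [Finset.card_erase_of_mem he.2, hc]
      obtain ⟨u, hu⟩ := Finset.card_eq_one.mp this
      have hu' : u ∈ e.erase v := by simp [hu]
      have hev : {v, u} = e := by rw [← hu, Finset.insert_erase he.2]
      refine ⟨u, ?_, hev⟩
      rw [Finset.mem_erase] at hu'
      rw [Finset.mem_filter, Finset.mem_erase, mem_vertices, hev]
      exact ⟨⟨hu'.1, f, hf, hef hu'.2⟩, he.1⟩
  lia

/-- If the contributions of the two faces along each edge at `v` other than `{v, u₀}` cancel, then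
the total contribution around `v` is that of the two faces along `{v, u₀}`. -/
theorem IsClosedSurface.sum_link_eq_pair (hF : IsClosedSurface F) {M : Type*} [AddCommMonoid M]
    {v u₀ : V} {h : Finset V → V → M}
    (hcancel : ∀ u, u ≠ v → u ≠ u₀ → ∀ f ∈ F, ∀ g ∈ F, f ≠ g → {v, u} ⊆ f → {v, u} ⊆ g →
      h f u + h g u = 0)
    {f g : Finset V} (hf : f ∈ F) (hg : g ∈ F) (hne : f ≠ g) (hu₀ : u₀ ≠ v)
    (hvf : {v, u₀} ⊆ f) (hvg : {v, u₀} ⊆ g) :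
    ∑ x ∈ F.filter (v ∈ ·), ∑ u ∈ x.erase v, h x u = h f u₀ + h g u₀ := by
  rw [sum_link_comm, Finset.sum_eq_single_of_mem u₀]
  · rw [hF.filter_eq_pair hf hg hne hvf hvg (Finset.card_pair hu₀.symm), Finset.sum_pair hne]
  · rw [Finset.mem_erase, mem_vertices]
    exact ⟨hu₀, f, hf, hvf (by simp)⟩
  · intro u hu hne'
    have huv := Finset.ne_of_mem_erase hu
    by_cases he : {v, u} ∈ edges F
    · obtain ⟨x, hx, y, hy, hxy, hvx, hvy, heq⟩ := hF.exists_two_faces he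
      rw [heq, Finset.sum_pair hxy]
      exact hcancel u huv hne' x hx y hy hxy hvx hvy
    · rw [Finset.filter_eq_empty_iff.mpr, Finset.sum_empty]
      exact fun x hx hs ↦ he (mem_edges.mpr ⟨x, hx, hs, Finset.card_pair huv.symm⟩)

/-- A function on the faces at `v` which does not change across the edges at `v`, except possibly
one of them, is constant. -/
theorem IsClosedSurface.eq_of_forall_adjacent_of_ne (hF : IsClosedSurface F) {C : Type*}
    {v u₀ : V} {k : Finset V → C}
    (hk : ∀ u, u ≠ v → u ≠ u₀ → ∀ f ∈ F, ∀ g ∈ F, f ≠ g → {v, u} ⊆ f → {v, u} ⊆ g → k f = k g)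
    {f g : Finset V} (hf : f ∈ F) (hg : g ∈ F) (hvf : v ∈ f) (hvg : v ∈ g) : k f = k g := by
  classical
  have hpair : ∀ x ∈ F, ∀ y ∈ F, x ≠ y → u₀ ≠ v → {v, u₀} ⊆ x → {v, u₀} ⊆ y → k x = k y := by
    intro x hx y hy hxy hu₀ hvx hvy
    have h := hF.sum_link_eq_pair (h := fun z _ ↦ if k z = k x then (1 : ZMod 2) else 0)
      (fun u huv huu f hf g hg hne hvf hvg ↦ by
        rw [hk u huv huu f hf g hg hne hvf hvg]
        exact CharTwo.add_self_eq_zero _) hx hy hxy hu₀ hvx hvy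
    rw [Finset.sum_eq_zero] at h
    · by_contra hne
      simp [Ne.symm hne] at h
    · intro z hz
      rw [Finset.mem_filter] at hz
      rw [Finset.sum_const, Finset.card_erase_of_mem hz.2, hF.card_eq_three hz.1]
      exact CharTwo.two_nsmul _
  have hlink := hF.2.2.2 v f hf g hg hvf hvg
  induction hlink with
  | refl => rfl
  | @tail x y _ hxy ih =>
    obtain ⟨hx, hy, hvx, hvy, hc⟩ := hxy
    refine (ih hx hvx).trans ?_
    have hvi : v ∈ x ∩ y := Finset.mem_inter.mpr ⟨hvx, hvy⟩
    have h1 : ((x ∩ y).erase v).card = 1 := by rw [Finset.card_erase_of_mem hvi, hc]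
    obtain ⟨u, hu⟩ := Finset.card_eq_one.mp h1
    have huv : u ≠ v := Finset.ne_of_mem_erase (hu ▸ Finset.mem_singleton_self u)
    have heq : {v, u} = x ∩ y := by rw [← hu, Finset.insert_erase hvi]
    have hxy : x ≠ y := by
      rintro rfl
      rw [Finset.inter_self, hF.card_eq_three hx] at hc
      lia
    by_cases huu : u = u₀
    · subst huu
      exact hpair x hx y hy hxy huv (heq ▸ Finset.inter_subset_left)
        (heq ▸ Finset.inter_subset_right)
    · exact hk u huv huu x hx y hy hxy (heq ▸ Finset.inter_subset_left)
        (heq ▸ Finset.inter_subset_right)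

/-- A labelling of the corners of each face by the vertices of a triangle of the six-vertex
projective plane. -/
def IsFaceLabelling (F : Finset (Finset V)) (s : Finset V → V → Fin 6) : Prop :=
  ∀ f ∈ F, f.image (s f) ∈ hemiFaces

/-- The labellings `φ` of `f` and `ψ` of `g` agree on the common corners and take distinct values
at the remaining ones: for adjacent triangles, `ψ` continues `φ` to the neighbouring triangle. -/
def Continues (f g : Finset V) (φ ψ : V → Fin 6) : Prop :=
  (∀ x ∈ f ∩ g, φ x = ψ x) ∧ ∀ x ∈ f \ g, ∀ y ∈ g \ f, φ x ≠ ψ y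

theorem Continues.symm {f g : Finset V} {φ ψ : V → Fin 6} (h : Continues f g φ ψ) :
    Continues g f ψ φ :=
  ⟨fun x hx ↦ (h.1 x (Finset.inter_comm f g ▸ hx)).symm, fun x hx y hy ↦ (h.2 y hy x hx).symm⟩

/-- The increment of the link coordinate around a vertex labelled `i`, along the link edge of `f`
starting at `u`. -/
def turn (s : Finset V → V → Fin 6) (v : V) (f : Finset V) (u : V) : ZMod 5 :=
  ∑ w ∈ f.erase v, linkCoord (s f v) (s f w) - 2 * linkCoord (s f v) (s f u)

theorem exists_eq_of_card_three {f : Finset V} (h : f.card = 3) {v u : V} (huv : u ≠ v)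
    (hf : {v, u} ⊆ f) : ∃ w, w ≠ v ∧ w ≠ u ∧ f = {v, u, w} := by
  have h1 : (f \ {v, u}).card = 1 := by
    rw [Finset.card_sdiff_of_subset hf, h, Finset.card_pair huv.symm]
  obtain ⟨w, hw⟩ := Finset.card_eq_one.mp h1
  have hw' : w ∈ f \ {v, u} := by simp [hw]
  simp only [Finset.mem_sdiff, Finset.mem_insert, Finset.mem_singleton, not_or] at hw'
  refine ⟨w, hw'.2.1, hw'.2.2, ?_⟩
  rw [← Finset.sdiff_union_of_subset hf, hw]
  ext; simp; tauto

theorem turn_eq (s : Finset V → V → Fin 6) {v u w : V} (huv : u ≠ v) (hwv : w ≠ v)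
    (hwu : w ≠ u) : turn s v {v, u, w} u =
      linkCoord (s {v, u, w} v) (s {v, u, w} w) - linkCoord (s {v, u, w} v) (s {v, u, w} u) := by
  have : ({v, u, w} : Finset V).erase v = {u, w} := by
    ext; simp; grind
  rw [turn, this, Finset.sum_pair hwu.symm]
  ring

theorem IsClosedSurface.continues_iff_turn (hF : IsClosedSurface F) {s : Finset V → V → Fin 6}
    (hs : IsFaceLabelling F s) {f g : Finset V} {v u : V} (hf : f ∈ F) (hg : g ∈ F)
    (hne : f ≠ g) (huv : u ≠ v) (hvf : {v, u} ⊆ f) (hvg : {v, u} ⊆ g) (hv : s f v = s g v) :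
    Continues f g (s f) (s g) ↔ turn s v f u + turn s v g u = 0 ∧
      turn s v f u * linkCoord (s f v) (s f u) + turn s v g u * linkCoord (s g v) (s g u) = 0 := by
  have hi := hF.inter_eq hf hg hne hvf hvg (Finset.card_pair huv.symm)
  obtain ⟨w, hwv, hwu, rfl⟩ := exists_eq_of_card_three (hF.card_eq_three hf) huv hvf
  obtain ⟨w', hwv', hwu', rfl⟩ := exists_eq_of_card_three (hF.card_eq_three hg) huv hvg
  have hf' := hs _ hf
  have hg' := hs _ hg
  simp only [Finset.image_insert, Finset.image_singleton] at hf' hg'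
  rw [turn_eq s huv hwv hwu, turn_eq s huv hwv' hwu']
  rw [← hv] at hg' ⊢
  rw [← linkCoord_pair_iff _ _ _ hf' _ _ hg']
  have hww : w ≠ w' := by rintro rfl; exact hne rfl
  have h1 : ({v, u, w} \ {v, u, w'} : Finset V) = {w} := by ext; simp; grind
  have h2 : ({v, u, w'} \ {v, u, w} : Finset V) = {w'} := by ext; simp; grind
  rw [Continues, hi, h1, h2]
  simp [hv]

theorem IsClosedSurface.sum_turn (hF : IsClosedSurface F) (s : Finset V → V → Fin 6)
    (v : V) : ∑ f ∈ F.filter (v ∈ ·), ∑ u ∈ f.erase v, turn s v f u = 0 := by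
  refine Finset.sum_eq_zero fun f hf ↦ ?_
  rw [Finset.mem_filter] at hf
  simp only [turn, Finset.sum_sub_distrib, Finset.sum_const, ← Finset.mul_sum]
  simp [Finset.card_erase_of_mem hf.2, hF.card_eq_three hf.1]

theorem IsClosedSurface.sum_turn_mul (hF : IsClosedSurface F) {s : Finset V → V → Fin 6}
    (hs : IsFaceLabelling F s) (v : V) :
    ∑ f ∈ F.filter (v ∈ ·), ∑ u ∈ f.erase v, turn s v f u * linkCoord (s f v) (s f u) =
      -(degree F v : ZMod 5) := by
  have : ∀ f ∈ F.filter (v ∈ ·),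
      ∑ u ∈ f.erase v, turn s v f u * linkCoord (s f v) (s f u) = -1 := by
    intro f hf
    rw [Finset.mem_filter] at hf
    have h2 : (f.erase v).card = 2 := by
      rw [Finset.card_erase_of_mem hf.2, hF.card_eq_three hf.1]
    obtain ⟨u, w, huw, he⟩ := Finset.card_eq_two.mp h2
    have hf' := hs f hf.1
    rw [← Finset.insert_erase hf.2, he, Finset.image_insert, Finset.image_insert,
      Finset.image_singleton, ← he, Finset.insert_erase hf.2] at hf'
    simp only [turn, he, Finset.sum_pair huw]
    linear_combination - linkCoord_sub_mul_self _ _ _ hf'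
  rw [Finset.sum_congr rfl this, Finset.sum_const, hF.degree_eq]
  simp

/-- If a face labelling continues across all edges at `v` except possibly `{v, u₀}`, then it
continues across `{v, u₀}` if and only if the degree of `v` is divisible by five. -/
theorem IsClosedSurface.five_dvd_degree_iff (hF : IsClosedSurface F) {s : Finset V → V → Fin 6}
    (hs : IsFaceLabelling F s) {v u₀ : V}
    (hcont : ∀ u, u ≠ v → u ≠ u₀ → ∀ f ∈ F, ∀ g ∈ F, f ≠ g → {v, u} ⊆ f → {v, u} ⊆ g →
      Continues f g (s f) (s g))
    {f g : Finset V} (hf : f ∈ F) (hg : g ∈ F) (hne : f ≠ g) (hu₀ : u₀ ≠ v)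
    (hvf : {v, u₀} ⊆ f) (hvg : {v, u₀} ⊆ g) :
    5 ∣ degree F v ↔ Continues f g (s f) (s g) := by
  have hlabel : ∀ f ∈ F, ∀ g ∈ F, v ∈ f → v ∈ g → s f v = s g v := by
    intro f hf g hg
    refine hF.eq_of_forall_adjacent_of_ne (u₀ := u₀) (k := fun f ↦ s f v) ?_ hf hg
    intro u huv huu x hx y hy hxy hvx hvy
    exact (hcont u huv huu x hx y hy hxy hvx hvy).1 v
      (Finset.mem_inter.mpr ⟨hvx (by simp), hvy (by simp)⟩)
  have hiff : ∀ u, u ≠ v → ∀ f ∈ F, ∀ g ∈ F, f ≠ g → {v, u} ⊆ f → {v, u} ⊆ g → _ :=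
    fun u huv f hf g hg hne hvf hvg ↦ hF.continues_iff_turn hs hf hg hne huv hvf hvg
      (hlabel f hf g hg (hvf (by simp)) (hvg (by simp)))
  rw [hiff u₀ hu₀ f hf g hg hne hvf hvg,
    ← hF.sum_link_eq_pair (h := turn s v) (fun u huv huu f hf g hg hne hvf hvg ↦
      ((hiff u huv f hf g hg hne hvf hvg).mp (hcont u huv huu f hf g hg hne hvf hvg)).1)
      hf hg hne hu₀ hvf hvg,
    ← hF.sum_link_eq_pair (h := fun f u ↦ turn s v f u * linkCoord (s f v) (s f u))
      (fun u huv huu f hf g hg hne hvf hvg ↦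
        ((hiff u huv f hf g hg hne hvf hvg).mp (hcont u huv huu f hf g hg hne hvf hvg)).2)
      hf hg hne hu₀ hvf hvg,
    hF.sum_turn, hF.sum_turn_mul hs]
  simp [ZMod.natCast_eq_zero_iff]

theorem exists_continues {f g : Finset V} (hf : f.card = 3) (hg : g.card = 3)
    (hfg : (f ∩ g).card = 2) {φ : V → Fin 6} (hφ : f.image φ ∈ hemiFaces) :
    ∃ ψ : V → Fin 6, g.image ψ ∈ hemiFaces ∧ Continues f g φ ψ := by
  obtain ⟨x, y, hxy, hi⟩ := Finset.card_eq_two.mp hfg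
  obtain ⟨z, hzx, hzy, rfl⟩ :=
    exists_eq_of_card_three hf hxy.symm (hi ▸ Finset.inter_subset_left)
  obtain ⟨w, hwx, hwy, rfl⟩ :=
    exists_eq_of_card_three hg hxy.symm (hi ▸ Finset.inter_subset_right)
  simp only [Finset.image_insert, Finset.image_singleton] at hφ
  obtain ⟨c, hc, hcmem⟩ := exists_ne_mem_hemiFaces _ _ _ hφ
  have hzw : z ≠ w := by
    rintro rfl
    rw [Finset.inter_self] at hfg
    lia
  have h1 : ({x, y, z} \ {x, y, w} : Finset V) = {z} := by ext; simp; grind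
  have h2 : ({x, y, w} \ {x, y, z} : Finset V) = {w} := by ext; simp; grind
  refine ⟨Function.update φ w c, ?_, ?_, ?_⟩
  · simpa [hwx.symm, hwy.symm] using hcmem
  · rw [hi]
    simp [hwx.symm, hwy.symm]
  · rw [h1, h2]
    simpa using hc.symm

/-- The graph on the faces in which two faces are adjacent if they share an edge. -/
def dualGraph (F : Finset (Finset V)) : SimpleGraph F where
  Adj f g := f ≠ g ∧ (f.1 ∩ g.1).card = 2
  symm := ⟨fun f g h ↦ ⟨h.1.symm, Finset.inter_comm f.1 g.1 ▸ h.2⟩⟩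
  loopless := ⟨fun _ h ↦ h.1 rfl⟩

/-- The graph formed by the vertices and those edges that are not crossed by the graph `T` on the
faces. -/
def uncrossedGraph (F : Finset (Finset V)) (T : SimpleGraph F) : SimpleGraph (vertices F) where
  Adj u w := u ≠ w ∧ {u.1, w.1} ∈ edges F ∧ ∀ f g, T.Adj f g → f.1 ∩ g.1 ≠ {u.1, w.1}
  symm := ⟨fun u w h ↦ ⟨h.1.symm, Finset.pair_comm u.1 w.1 ▸ h.2⟩⟩
  loopless := ⟨fun _ h ↦ h.1 rfl⟩

namespace IsClosedSurface

theorem dualGraph_connected (hF : IsClosedSurface F) (hconn : FacesConnected F) :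
    (dualGraph F).Connected := by
  obtain ⟨f₀, hf₀⟩ := hF.1
  rw [SimpleGraph.connected_iff]
  refine ⟨fun f g ↦ ?_, ⟨⟨f₀, hf₀⟩⟩⟩
  obtain ⟨f, hf⟩ := f
  obtain ⟨g, hg⟩ := g
  have h := hconn f hf g hg
  induction h with
  | refl => rfl
  | @tail x y _ hxy ih =>
    obtain ⟨hx, hy, hc⟩ := hxy
    refine (ih hx).trans (SimpleGraph.Adj.reachable ⟨?_, hc⟩)
    intro h
    obtain rfl : x = y := congrArg Subtype.val h
    rw [Finset.inter_self, hF.card_eq_three hx] at hc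
    lia

/-- The edges not crossed by a dual forest connect all vertices. -/
theorem uncrossedGraph_connected (hF : IsClosedSurface F) (hconn : FacesConnected F)
    {T : SimpleGraph F} (hT : T.IsAcyclic) : (uncrossedGraph F T).Connected := by
  classical
  obtain ⟨f₀, hf₀⟩ := hF.1
  obtain ⟨v₀, hv₀⟩ : f₀.Nonempty := Finset.card_pos.mp (by rw [hF.card_eq_three hf₀]; lia)
  rw [SimpleGraph.connected_iff]
  refine ⟨fun a b ↦ ?_, ⟨⟨v₀, mem_vertices.mpr ⟨f₀, hf₀, hv₀⟩⟩⟩⟩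
  let A : V → Prop := fun v ↦ ∃ h : v ∈ vertices F, (uncrossedGraph F T).Reachable a ⟨v, h⟩
  have hA : ∀ u w, u ≠ w → {u, w} ∈ edges F → A u → ¬ A w →
      ∃ f g, T.Adj f g ∧ f.1 ∩ g.1 = {u, w} := by
    rintro u w huw he ⟨hu, hau⟩ hw
    by_contra! hno
    obtain ⟨f, hf, hef, -⟩ := mem_edges.mp he
    have hwv : w ∈ vertices F := mem_vertices.mpr ⟨f, hf, hef (by simp)⟩
    have hadj : (uncrossedGraph F T).Adj ⟨u, hu⟩ ⟨w, hwv⟩ :=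
      ⟨fun h ↦ huw (congrArg Subtype.val h), he, hno⟩
    exact hw ⟨hwv, hau.trans hadj.reachable⟩
  let H : SimpleGraph F :=
    { Adj := fun f g ↦ T.Adj f g ∧ ∃ u w, f.1 ∩ g.1 = {u, w} ∧ A u ∧ ¬ A w
      symm := ⟨fun f g h ↦ ⟨h.1.symm, Finset.inter_comm f.1 g.1 ▸ h.2⟩⟩
      loopless := ⟨fun f h ↦ h.1.ne rfl⟩ }
  have hcross : ∀ f : F, ∀ u ∈ f.1, ∀ w ∈ f.1, A u → ¬ A w →
      ∃ g, H.Adj f g ∧ f.1 ∩ g.1 = {u, w} := by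
    intro f u hu w hw hAu hAw
    have huw : u ≠ w := by rintro rfl; exact hAw hAu
    have hef : {u, w} ⊆ f.1 := by
      simp [Finset.insert_subset_iff, hu, hw]
    have he : {u, w} ∈ edges F := mem_edges.mpr ⟨f, f.2, hef, Finset.card_pair huw⟩
    obtain ⟨g, g', hgg, hi⟩ := hA u w huw he hAu hAw
    have hne : g.1 ≠ g'.1 := fun h ↦ hgg.ne (Subtype.ext h)
    have hf : f.1 ∈ F.filter (fun x ↦ {u, w} ⊆ x) := Finset.mem_filter.mpr ⟨f.2, hef⟩
    rw [hF.filter_eq_pair g.2 g'.2 hne (hi ▸ Finset.inter_subset_left)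
      (hi ▸ Finset.inter_subset_right) (Finset.card_pair huw), Finset.mem_insert,
      Finset.mem_singleton] at hf
    rcases hf with hf | hf
    · obtain rfl := Subtype.ext hf
      exact ⟨g', ⟨hgg, u, w, hi, hAu, hAw⟩, hi⟩
    · obtain rfl := Subtype.ext hf
      rw [Finset.inter_comm] at hi
      exact ⟨g, ⟨hgg.symm, u, w, hi, hAu, hAw⟩, hi⟩
  have hbot : H = ⊥ := by
    by_contra hne
    obtain ⟨f, g, -, hfg, huniq⟩ :=
      (hT.anti (fun f g (h : H.Adj f g) ↦ h.1)).exists_leaf_ne hne ⟨f₀, hf₀⟩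
    obtain ⟨-, u, w, hi, hAu, hAw⟩ := id hfg
    have huw : u ≠ w := by rintro rfl; exact hAw hAu
    obtain ⟨z, hzu, hzw, hf⟩ := exists_eq_of_card_three (hF.card_eq_three f.2) huw.symm
      (hi ▸ Finset.inter_subset_left)
    have hz : z ∉ f.1 ∩ g.1 := by simp [hi, hzu, hzw]
    have hu : u ∈ f.1 := by simp [hf]
    have hw : w ∈ f.1 := by simp [hf]
    have hzf : z ∈ f.1 := by simp [hf]
    by_cases hAz : A z
    · obtain ⟨g', hg', hi'⟩ := hcross f z hzf w hw hAz hAw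
      obtain rfl := huniq g' hg'
      exact hz (by simp [hi'])
    · obtain ⟨g', hg', hi'⟩ := hcross f u hu z hzf hAu hAz
      obtain rfl := huniq g' hg'
      exact hz (by simp [hi'])
  have hmono : ∀ f ∈ F, ∀ u ∈ f, ∀ w ∈ f, A u → A w := by
    intro f hf u hu w hw hAu
    by_contra hAw
    obtain ⟨g, hg, -⟩ := hcross ⟨f, hf⟩ u hu w hw hAu hAw
    simp [hbot] at hg
  obtain ⟨f, hf, haf⟩ := mem_vertices.mp a.2
  obtain ⟨g, hg, hbg⟩ := mem_vertices.mp b.2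
  have hall : ∀ u ∈ g, A u := by
    have h := hconn f hf g hg
    clear hbg
    induction h with
    | refl => exact fun u hu ↦ hmono f hf a haf u hu ⟨a.2, .rfl⟩
    | @tail x y _ hxy ih =>
      obtain ⟨hx, hy, hc⟩ := hxy
      obtain ⟨u, hu⟩ : (x ∩ y).Nonempty := Finset.card_pos.mp (by lia)
      rw [Finset.mem_inter] at hu
      exact fun w hw ↦ hmono y hy u hu.2 w hw (ih hx u hu.1)
  exact (hall b hbg).2

/-- Tree-cotree decomposition: on a sphere, the edges not crossed by a spanning tree of the dual
graph form a spanning tree. -/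
theorem uncrossedGraph_isTree (hF : IsClosedSurface F) (hconn : FacesConnected F)
    (hχ : eulerChar F = 2) {T : SimpleGraph F} (hTle : T ≤ dualGraph F) (hT : T.IsTree) :
    (uncrossedGraph F T).IsTree := by
  classical
  have hP := hF.uncrossedGraph_connected hconn hT.isAcyclic
  refine SimpleGraph.isTree_iff_connected_and_card.mpr ⟨hP, ?_⟩
  have hPle := hP.card_vert_le_card_edgeSet_add_one
  have hTcard := hT.card_edgeFinset
  let crossing : Sym2 F → Finset V :=
    Sym2.lift ⟨fun f g ↦ f.1 ∩ g.1, fun f g ↦ Finset.inter_comm f.1 g.1⟩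
  let ends : Sym2 (vertices F) → Finset V := fun e ↦ (e.map Subtype.val).toFinset
  have hcrossed : (T.edgeFinset.image crossing).card = T.edgeFinset.card := by
    apply Finset.card_image_of_injOn
    intro d
    induction d with | _ f g
    intro hd d'
    induction d' with | _ f' g'
    intro hd' heq
    simp only [Finset.mem_coe, SimpleGraph.mem_edgeFinset, SimpleGraph.mem_edgeSet] at hd hd'
    replace heq : f.1 ∩ g.1 = f'.1 ∩ g'.1 := heq
    have hc := (hTle hd).2
    have hfil := hF.filter_eq_pair f.2 g.2 (fun h ↦ hd.ne (Subtype.ext h))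
      Finset.inter_subset_left Finset.inter_subset_right hc
    have hfil' := hF.filter_eq_pair f'.2 g'.2 (fun h ↦ hd'.ne (Subtype.ext h))
      (heq ▸ Finset.inter_subset_left) (heq ▸ Finset.inter_subset_right) hc
    rw [hfil] at hfil'
    have h1 : f.1 ∈ ({f'.1, g'.1} : Finset (Finset V)) := hfil' ▸ by simp
    have h2 : g.1 ∈ ({f'.1, g'.1} : Finset (Finset V)) := hfil' ▸ by simp
    have hne := hd.ne
    simp only [Finset.mem_insert, Finset.mem_singleton, SetLike.coe_eq_coe] at h1 h2
    rw [Sym2.eq_iff]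
    grind
  have hends : (uncrossedGraph F T).edgeFinset.card ≤
      (edges F \ T.edgeFinset.image crossing).card := by
    apply Finset.card_le_card_of_injOn ends
    · intro e
      induction e with | _ u w
      intro h
      simp only [Finset.mem_coe, SimpleGraph.mem_edgeFinset, SimpleGraph.mem_edgeSet] at h
      obtain ⟨-, he, hno⟩ := h
      simp only [ends, Sym2.map_mk, Sym2.toFinset_mk_eq, Finset.mem_coe, Finset.mem_sdiff,
        Finset.mem_image, not_exists, not_and]
      refine ⟨he, fun d ↦ ?_⟩
      induction d with | _ f g
      intro hd
      exact hno f g (by simpa using hd)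
    · intro e _ e' _ heq
      apply Sym2.map.injective Subtype.val_injective
      ext x
      rw [← Sym2.mem_toFinset, ← Sym2.mem_toFinset]
      exact iff_of_eq (congrArg (x ∈ ·) heq)
  have hsub : T.edgeFinset.image crossing ⊆ edges F := by
    intro e he
    rw [Finset.mem_image] at he
    obtain ⟨d, hd, rfl⟩ := he
    induction d with | _ f g
    rw [SimpleGraph.mem_edgeFinset, SimpleGraph.mem_edgeSet] at hd
    exact mem_edges.mpr ⟨f, f.2, Finset.inter_subset_left, (hTle hd).2⟩
  rw [Finset.card_sdiff_of_subset hsub, hcrossed] at hends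
  have hle := Finset.card_le_card hsub
  rw [hcrossed] at hle
  rw [Nat.card_eq_fintype_card, Nat.card_eq_fintype_card, ← SimpleGraph.edgeFinset_card,
    Fintype.card_coe] at *
  rw [eulerChar] at hχ
  lia

end IsClosedSurface

end Fisk

open Fisk in
/-- There is no triangulation of the 2-sphere in which the degrees of all
vertices except exactly one are divisible by 5. -/
theorem no_sphere_one_exceptional_mod_five {V : Type*} [DecidableEq V] :
    ¬ ∃ (F : Finset (Finset V)) (a : V),
        IsSphere F ∧ a ∈ vertices F ∧ ¬ (5 ∣ degree F a) ∧
        (∀ v ∈ vertices F, v ≠ a → 5 ∣ degree F v) := by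
  rintro ⟨F, a, ⟨hF, hconn, hχ⟩, ha, hdeg, hdvd⟩
  obtain ⟨T, hTle, hT⟩ := (hF.dualGraph_connected hconn).exists_isTree_le
  have hP := hF.uncrossedGraph_isTree hconn hχ hTle hT
  obtain ⟨s', hs', hsT⟩ := hT.isAcyclic.exists_compatible_labelling
    (X := V → Fin 6) (R := fun f g ↦ Continues f.1 g.1)
    (p := fun f φ ↦ f.1.image φ ∈ hemiFaces)
    (fun f ↦ by
      obtain ⟨x, y, z, hxy, hxz, hyz, hf⟩ := Finset.card_eq_three.mp (hF.card_eq_three f.2)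
      refine ⟨fun v ↦ if v = x then 5 else if v = y then 0 else 1, ?_⟩
      rw [hf]
      simp [hxy.symm, hxz.symm, hyz.symm, hemiFaces])
    (fun _ _ _ _ h ↦ h.symm) T
    (fun f g hfg φ hφ ↦ exists_continues (hF.card_eq_three f.2) (hF.card_eq_three g.2)
      (hTle hfg).2 hφ)
  let s : Finset V → V → Fin 6 := fun f ↦ if h : f ∈ F then s' ⟨f, h⟩ else 0
  have hval : ∀ f : F, s f = s' f := fun f ↦ by simp [s]
  have hs : IsFaceLabelling F s := fun f hf ↦ hval ⟨f, hf⟩ ▸ hs' ⟨f, hf⟩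
  let B : SimpleGraph (vertices F) :=
    { Adj := fun u w ↦ u ≠ w ∧ ∃ f ∈ F, ∃ g ∈ F, f ≠ g ∧ {u.1, w.1} ⊆ f ∧ {u.1, w.1} ⊆ g ∧
        ¬ Continues f g (s f) (s g)
      symm := ⟨fun u w h ↦ ⟨h.1.symm, Finset.pair_comm u.1 w.1 ▸ h.2⟩⟩
      loopless := ⟨fun _ h ↦ h.1 rfl⟩ }
  have hBP : B ≤ uncrossedGraph F T := by
    rintro u w ⟨huw, f, hf, g, hg, hne, hef, heg, hno⟩
    have hc : ({u.1, w.1} : Finset V).card = 2 :=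
      Finset.card_pair fun h ↦ huw (Subtype.ext h)
    refine ⟨huw, mem_edges.mpr ⟨f, hf, hef, hc⟩, fun x y hxy hi ↦ ?_⟩
    have hfil := hF.filter_eq_pair hf hg hne hef heg hc
    have hx : x.1 ∈ F.filter (fun z ↦ {u.1, w.1} ⊆ z) :=
      Finset.mem_filter.mpr ⟨x.2, hi ▸ Finset.inter_subset_left⟩
    have hy : y.1 ∈ F.filter (fun z ↦ {u.1, w.1} ⊆ z) :=
      Finset.mem_filter.mpr ⟨y.2, hi ▸ Finset.inter_subset_right⟩
    have hxy' : x.1 ≠ y.1 := fun h ↦ hxy.ne (Subtype.ext h)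
    have hcont := hsT x y hxy
    rw [← hval, ← hval] at hcont
    simp only [hfil, Finset.mem_insert, Finset.mem_singleton] at hx hy
    rcases hx with hx | hx <;> rcases hy with hy | hy
    · exact hxy' (hx.trans hy.symm)
    · exact hno (hx ▸ hy ▸ hcont)
    · exact hno (hx ▸ hy ▸ hcont.symm)
    · exact hxy' (hx.trans hy.symm)
  have hvert : ∀ {f : Finset V} {v}, f ∈ F → v ∈ f → v ∈ vertices F :=
    fun hf hv ↦ mem_vertices.mpr ⟨_, hf, hv⟩
  have hB : B = ⊥ := by
    by_contra hne
    obtain ⟨v, w, hva, ⟨hvw, f, hf, g, hg, hfg, hef, heg, hno⟩, huniq⟩ :=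
      (hP.isAcyclic.anti hBP).exists_leaf_ne hne ⟨a, ha⟩
    refine hno ((hF.five_dvd_degree_iff hs ?_ hf hg hfg (fun h ↦ hvw (Subtype.ext h.symm))
      hef heg).mp (hdvd v v.2 fun h ↦ hva (Subtype.ext h)))
    intro u huv huw x hx y hy hxy hvx hvy
    by_contra hcont
    have hu : u ∈ vertices F := hvert hx (hvx (by simp))
    exact huw (congrArg Subtype.val (huniq ⟨u, hu⟩
      ⟨fun h ↦ huv (congrArg Subtype.val h).symm, x, hx, y, hy, hxy, hvx, hvy, hcont⟩))
  have hcont : ∀ u, u ≠ a → ∀ f ∈ F, ∀ g ∈ F, f ≠ g → {a, u} ⊆ f → {a, u} ⊆ g →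
      Continues f g (s f) (s g) := by
    intro u hua f hf g hg hfg haf hag
    by_contra hno
    have hu : u ∈ vertices F := hvert hf (haf (by simp))
    have : B.Adj ⟨a, ha⟩ ⟨u, hu⟩ :=
      ⟨fun h ↦ hua (congrArg Subtype.val h).symm, f, hf, g, hg, hfg, haf, hag, hno⟩
    simp [hB] at this
  obtain ⟨f, hf, haf⟩ := mem_vertices.mp ha
  obtain ⟨u, hu, hua⟩ := Finset.exists_mem_ne (by rw [hF.card_eq_three hf]; lia) a
  have he : {a, u} ∈ edges F := mem_edges.mpr
    ⟨f, hf, by simp [Finset.insert_subset_iff, haf, hu], Finset.card_pair hua.symm⟩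
  obtain ⟨x, hx, y, hy, hxy, hax, hay, -⟩ := hF.exists_two_faces he
  exact hdeg ((hF.five_dvd_degree_iff hs (fun u hua _ ↦ hcont u hua) hx hy hxy hua hax hay).mpr
    (hcont u hua x hx y hy hxy hax hay))
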